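/- Under the hypotheses above, there exists ε₀ > 0 such that g(t) = −(a²/b²)t − log E[exp(t Z)] is strictly decreasing on (−ε₀, 0]. In particular lim_{t→0⁻} g'(t) < 0. -/

import Mathlib

open scoped ProbabilityTheory
open MeasureTheory Real Filter

lemma aux_W {Ω : Type*} [MeasureSpace Ω] [IsProbabilityMeasure (ℙ : Measure Ω)]
    (X : Ω → ℝ) (hX : Measurable X)
    (hmom : (∫ ω, X ω) = 0 ∨ ¬ Integrable (fun ω => (X ω) ^ 2)) (d : ℝ) :
    ENNReal.ofReal (d ^ 2) ≤ ∫⁻ ω, ENNReal.ofReal ((X ω - d) ^ 2) := by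
  by_cases hI : Integrable (fun ω => (X ω - d) ^ 2)
  · have h2 : MemLp (fun ω => X ω - d) 2 ℙ :=
      (memLp_two_iff_integrable_sq (by fun_prop)).2 hI
    have h3 : MemLp X 2 ℙ := by
      have := h2.add (memLp_const d)
      refine this.congr_norm (by fun_prop) ?_
      filter_upwards with ω
      simp
    have h4 : Integrable (fun ω => (X ω) ^ 2) := h3.integrable_sq
    have h5 : Integrable X := h3.integrable (by norm_num)
    have h6 : (∫ ω, X ω) = 0 := by
      rcases hmom with h | h
      · exact h
      · exact absurd h4 h
    rw [← ofReal_integral_eq_lintegral_ofReal hI (Eventually.of_forall fun ω => sq_nonneg _)]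
    apply ENNReal.ofReal_le_ofReal
    have h7 : (∫ ω, (X ω - d) ^ 2) = (∫ ω, (X ω) ^ 2) - (∫ ω, 2 * d * X ω) + ∫ ω : Ω, d ^ 2 := by
      rw [← integral_sub h4 (h5.const_mul _), 
        ← integral_add (f := fun ω => X ω ^ 2 - 2 * d * X ω) (h4.sub (h5.const_mul _))
          (integrable_const _)]
      congr 1
      ext ω
      ring
    rw [h7, integral_const_mul, h6]
    have : 0 ≤ ∫ ω, (X ω) ^ 2 := integral_nonneg fun ω => sq_nonneg _
    simp
    exact this
  · have : ∫⁻ ω, ENNReal.ofReal ((X ω - d) ^ 2) = ⊤ := by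
      by_contra h
      apply hI
      refine ⟨by fun_prop, ?_⟩
      rw [hasFiniteIntegral_iff_ofReal (Eventually.of_forall fun ω => sq_nonneg _)]
      exact lt_top_iff_ne_top.2 h
    rw [this]
    exact le_top

lemma aux_mono {w s t : ℝ} (hw : 0 ≤ w) (h : s ≤ t) : w * exp (s * w) ≤ w * exp (t * w) := by
  gcongr

lemma aux_K {Ω : Type*} [MeasureSpace Ω] [IsProbabilityMeasure (ℙ : Measure Ω)]
    (W : Ω → ℝ) (hW : Measurable W) (h0 : ∀ ω, 0 ≤ W ω) (K : ENNReal)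
    (hK : K < ∫⁻ ω, ENNReal.ofReal (W ω)) :
    ∃ ε > (0 : ℝ), ∀ t > -ε, K < ∫⁻ ω, ENNReal.ofReal (W ω * exp (t * W ω)) := by
  have hlim : Tendsto (fun n : ℕ => ∫⁻ ω, ENNReal.ofReal (W ω * exp ((-(1 / ((n : ℝ) + 1))) * W ω)))
      atTop (nhds (∫⁻ ω, ENNReal.ofReal (W ω))) := by
    apply lintegral_tendsto_of_tendsto_of_monotone
    · intro n; fun_prop
    · refine Eventually.of_forall fun ω n m hnm => ?_
      apply ENNReal.ofReal_le_ofReal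
      apply aux_mono (h0 ω)
      apply neg_le_neg
      exact one_div_le_one_div_of_le (by positivity) (by gcongr)
    · refine Eventually.of_forall fun ω => ?_
      apply ENNReal.tendsto_ofReal
      have h1 := (tendsto_one_div_add_atTop_nhds_zero_nat (𝕜 := ℝ)).neg
      have h2 : Tendsto (fun x : ℝ => W ω * exp (x * W ω)) (nhds (-0)) (nhds (W ω * exp ((-0) * W ω))) :=
        Continuous.tendsto (by fun_prop) _
      simpa [Function.comp_def] using h2.comp h1
  obtain ⟨n, hn⟩ := (hlim.eventually (lt_mem_nhds hK)).exists
  refine ⟨1 / ((n : ℝ) + 1), by positivity, fun t ht => hn.trans_le ?_⟩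
  apply lintegral_mono
  intro ω
  exact ENNReal.ofReal_le_ofReal (aux_mono (h0 ω) ht.le)

lemma aux_int {Ω : Type*} [MeasureSpace Ω] [IsProbabilityMeasure (ℙ : Measure Ω)]
    (W : Ω → ℝ) (hW : Measurable W) (h0 : ∀ ω, 0 ≤ W ω) {t : ℝ} (ht : t ≤ 0) :
    Integrable (fun ω => exp (t * W ω)) := by
  refine (integrable_const (1 : ℝ)).mono' (by fun_prop) (Eventually.of_forall fun ω => ?_)
  rw [norm_of_nonneg (exp_pos _).le]
  exact exp_le_one_iff.2 (mul_nonpos_of_nonpos_of_nonneg ht (h0 ω))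




/-- There exists ε₀ > 0 such that g(t) = −(a²/b²)t − log E[exp(tZ)] is strictly
decreasing on (−ε₀, 0]; in particular the limit of g' at 0 from the left is < 0. -/
theorem stmt5 {Ω : Type*} [MeasureSpace Ω] [IsProbabilityMeasure (ℙ : Measure Ω)]
    (X : Ω → ℝ) (hX : Measurable X)
    (hmom : (∫ ω, X ω) = 0 ∨ ¬ Integrable (fun ω => (X ω) ^ 2))
    (hsupp : ∃ x y z : ℝ, x ≠ y ∧ x ≠ z ∧ y ≠ z ∧
      (∀ ε > (0 : ℝ), 0 < ℙ {ω | X ω ∈ Set.Ioo (x - ε) (x + ε)}) ∧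
      (∀ ε > (0 : ℝ), 0 < ℙ {ω | X ω ∈ Set.Ioo (y - ε) (y + ε)}) ∧
      (∀ ε > (0 : ℝ), 0 < ℙ {ω | X ω ∈ Set.Ioo (z - ε) (z + ε)}))
    (a b : ℝ) (ha : 0 < a) (hb : 0 < b) (hb1 : b < 1) :
    ∃ ε₀ > (0 : ℝ),
      StrictAntiOn (fun t : ℝ => (-(a ^ 2 / b ^ 2)) * t -
          Real.log (∫ ω, Real.exp (t * ((X ω) ^ 2 - (2 * a / b ^ 2) * X ω))))
        (Set.Ioc (-ε₀) 0) ∧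
      Filter.limsup (fun t : ℝ =>
          ((deriv (fun s : ℝ => (-(a ^ 2 / b ^ 2)) * s -
            Real.log (∫ ω, Real.exp (s * ((X ω) ^ 2 - (2 * a / b ^ 2) * X ω)))) t : ℝ) : EReal))
        (nhdsWithin 0 (Set.Iio 0)) < 0 := by
  have hb0 : b ≠ 0 := hb.ne'
  set d : ℝ := a / b ^ 2 with hd
  set r : ℝ := a ^ 2 / b ^ 2 with hr
  have hrpos : 0 < r := by positivity
  have hdpos : 0 < d := by positivity
  let W : Ω → ℝ := fun ω => (X ω - d) ^ 2
  have hW : Measurable W := by fun_prop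
  have h0 : ∀ ω, 0 ≤ W ω := fun ω => sq_nonneg _
  have hmpos : ∀ t ≤ 0, 0 < ProbabilityTheory.mgf W ℙ t := fun t ht =>
    ProbabilityTheory.mgf_pos (aux_int W hW h0 ht)
  have hgeq : ∀ t ≤ 0, (-r) * t -
      Real.log (∫ ω, Real.exp (t * ((X ω) ^ 2 - (2 * a / b ^ 2) * X ω))) =
      (d ^ 2 - r) * t - ProbabilityTheory.cgf W ℙ t := by
    intro t ht
    have : ∀ ω, Real.exp (t * ((X ω) ^ 2 - (2 * a / b ^ 2) * X ω)) =
        exp (-(t * d ^ 2)) * exp (t * W ω) := by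
      intro ω
      rw [← exp_add]
      congr 1
      simp only [W, hd]
      ring
    simp_rw [this]
    rw [integral_const_mul]
    change (-r) * t - log (exp (-(t * d ^ 2)) * ProbabilityTheory.mgf W ℙ t) = _
    rw [log_mul (exp_pos _).ne' (hmpos t ht).ne', log_exp, ProbabilityTheory.cgf]
    ring
  have hint : ∀ t < 0, t ∈ interior (ProbabilityTheory.integrableExpSet W ℙ) := by
    intro t ht
    rw [mem_interior]
    exact ⟨Set.Iio 0, fun s hs => aux_int W hW h0 (le_of_lt hs), isOpen_Iio, ht⟩
  obtain ⟨ε, hε, hK⟩ := aux_K W hW h0 (ENNReal.ofReal (d ^ 2 - r / 2))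
    (lt_of_lt_of_le ((ENNReal.ofReal_lt_ofReal_iff (by positivity)).2 (by linarith))
      (aux_W X hX hmom d))
  have hderiv : ∀ t, -ε < t → t < 0 → deriv (fun t : ℝ => (-r) * t -
      Real.log (∫ ω, Real.exp (t * ((X ω) ^ 2 - (2 * a / b ^ 2) * X ω)))) t ≤ -(r / 2) := by
    intro t h1 h2
    have he : (fun t : ℝ => (-r) * t -
      Real.log (∫ ω, Real.exp (t * ((X ω) ^ 2 - (2 * a / b ^ 2) * X ω)))) =ᶠ[nhds t]
        fun t => (d ^ 2 - r) * t - ProbabilityTheory.cgf W ℙ t := by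
      filter_upwards [Iio_mem_nhds h2] with s hs using hgeq s (le_of_lt hs)
    rw [he.deriv_eq]
    have hdc : DifferentiableAt ℝ (ProbabilityTheory.cgf W ℙ) t :=
      (ProbabilityTheory.analyticAt_cgf (hint t h2)).differentiableAt
    rw [deriv_fun_sub (by fun_prop) hdc, ProbabilityTheory.deriv_cgf (hint t h2)]
    have hd1 : deriv (fun t : ℝ => (d ^ 2 - r) * t) t = d ^ 2 - r := by
      simpa using ((hasDerivAt_id t).const_mul (d ^ 2 - r)).deriv
    rw [hd1]
    have hi : Integrable (fun ω => W ω * exp (t * W ω)) := by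
      simpa using ProbabilityTheory.integrable_pow_mul_exp_of_mem_interior_integrableExpSet
        (hint t h2) 1
    have hnn : ∀ ω, 0 ≤ W ω * exp (t * W ω) := fun ω => mul_nonneg (h0 ω) (exp_pos _).le
    have h3 := hK t h1
    rw [← ofReal_integral_eq_lintegral_ofReal hi (Eventually.of_forall hnn)] at h3
    have h4 : d ^ 2 - r / 2 < ∫ ω, W ω * exp (t * W ω) := ENNReal.ofReal_lt_ofReal_iff'.1 h3 |>.1
    have h5 : ProbabilityTheory.mgf W ℙ t ≤ 1 := by
      have : ProbabilityTheory.mgf W ℙ t ≤ ∫ ω : Ω, (1 : ℝ) := by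
        apply integral_mono (aux_int W hW h0 h2.le) (integrable_const _)
        intro ω
        exact exp_le_one_iff.2 (mul_nonpos_of_nonpos_of_nonneg h2.le (h0 ω))
      simpa using this
    have h6 : (∫ ω, W ω * exp (t * W ω)) ≤
        (∫ ω, W ω * exp (t * W ω)) / ProbabilityTheory.mgf W ℙ t :=
      le_div_self (integral_nonneg hnn) (hmpos t h2.le) h5
    linarith
  refine ⟨ε, hε, ?_, ?_⟩
  · apply strictAntiOn_of_deriv_neg (convex_Ioc _ _)
    · have hc : ContinuousOn (ProbabilityTheory.mgf W ℙ) (Set.Ioc (-ε) 0) := by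
        apply continuousOn_of_dominated (bound := fun _ => (1 : ℝ))
        · intro t _; fun_prop
        · intro t ht
          refine Eventually.of_forall fun ω => ?_
          rw [norm_of_nonneg (exp_pos _).le]
          exact exp_le_one_iff.2 (mul_nonpos_of_nonpos_of_nonneg ht.2 (h0 ω))
        · exact integrable_const _
        · exact Eventually.of_forall fun ω => by fun_prop
      have hc2 : ContinuousOn (fun t => (d ^ 2 - r) * t - ProbabilityTheory.cgf W ℙ t)
          (Set.Ioc (-ε) 0) :=
        ContinuousOn.sub (by fun_prop) (hc.log fun t ht => (hmpos t ht.2).ne')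
      exact hc2.congr fun t ht => hgeq t ht.2
    · intro t ht
      rw [interior_Ioc] at ht
      have := hderiv t ht.1 ht.2
      linarith
  · have hlt : ((-(r / 2) : ℝ) : EReal) < 0 := by
      exact_mod_cast (by linarith : -(r / 2) < 0)
    refine lt_of_le_of_lt ?_ hlt
    apply limsup_le_of_le
    · isBoundedDefault
    · filter_upwards [Ioo_mem_nhdsLT (show -ε < 0 by linarith)] with t ht
      exact EReal.coe_le_coe_iff.2 (hderiv t ht.1 ht.2)
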